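/- arXiv:hep-th/0509041 — 6 statements merged into one kernel-verified Lean document; each statement's English description precedes it below -/
import Mathlib

section
/- Let t > 0 and p > 0 be real numbers. If 0 < p ≤ 2, then arctan(√(e^{t/p} − 1)) ≤ π/p holds for every t > 0. If p > 2, then arctan(√(e^{t/p} − 1)) ≤ π/p holds if and only if t ≤ p·log(sec²(π/p)) = −2p·log(cos(π/p)). -/
/-- For an angle `θ` in the first quadrant, `arctan √(e^s − 1) ≤ θ` iff `s ≤ log (sec² θ)`. -/
theorem arctan_sqrt_exp_sub_one_le_iff {s θ : ℝ} (hθ : 0 < θ) (hθ' : θ < Real.pi / 2) :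
    Real.arctan (Real.sqrt (Real.exp s - 1)) ≤ θ ↔
      s ≤ Real.log ((1 / Real.cos θ) ^ 2) := by
  have hcos : 0 < Real.cos θ := Real.cos_pos_of_mem_Ioo ⟨by linarith, hθ'⟩
  have htan : 0 < Real.tan θ := Real.tan_pos_of_pos_of_lt_pi_div_two hθ hθ'
  have hsec : (1 / Real.cos θ) ^ 2 = 1 + Real.tan θ ^ 2 := by
    rw [one_div, inv_pow, ← Real.inv_one_add_tan_sq hcos.ne', inv_inv]
  rw [Real.le_log_iff_exp_le (by positivity), hsec]
  conv_lhs => rw [← Real.arctan_tan (by linarith) hθ']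
  rw [Real.arctan_strictMono.le_iff_le, Real.sqrt_le_left htan.le, sub_le_iff_le_add']

/-- The constraint ρ(0) ≤ 1 on the one-cut density of q-deformed Yang–Mills on S²:
for `0 < p ≤ 2` the inequality `arctan √(e^{t/p} − 1) ≤ π/p` holds for all `t > 0`,
while for `p > 2` it holds iff `t ≤ p·log(sec²(π/p)) = −2p·log(cos(π/p))`. -/
theorem qYM_one_cut_bound (p : ℝ) (hp : 0 < p) :
    (p ≤ 2 → ∀ t : ℝ, 0 < t →
      Real.arctan (Real.sqrt (Real.exp (t / p) - 1)) ≤ Real.pi / p) ∧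
    (2 < p →
      (p * Real.log ((1 / Real.cos (Real.pi / p)) ^ 2)
          = -2 * p * Real.log (Real.cos (Real.pi / p))) ∧
      ∀ t : ℝ, 0 < t →
        (Real.arctan (Real.sqrt (Real.exp (t / p) - 1)) ≤ Real.pi / p ↔
          t ≤ p * Real.log ((1 / Real.cos (Real.pi / p)) ^ 2))) := by
  refine ⟨fun hp2 t _ => ?_, fun hp2 => ⟨?_, fun t _ => ?_⟩⟩
  · exact (Real.arctan_lt_pi_div_two _).le.trans
      (div_le_div_of_nonneg_left Real.pi_pos.le hp hp2)
  · rw [one_div, inv_pow, Real.log_inv, Real.log_pow]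
    push_cast
    ring
  · rw [arctan_sqrt_exp_sub_one_le_iff (div_pos Real.pi_pos hp)
      (div_lt_div_of_pos_left Real.pi_pos two_pos hp2), div_le_iff₀' hp]
end

section
/- For all real t, a > 0, the one-cut density is a probability density: ∫_{−b}^{b} ρ(z) dz = 1. -/
open intervalIntegral in
/-- The integral of `cos² / (p² sin² + q² cos²)` over a half period. -/
theorem integral_cos_sq_div_mul_sin_sq_add_mul_cos_sq {p q : ℝ} (hp : 0 < p) (hq : 0 < q) :
    ∫ x in (-(Real.pi / 2))..(Real.pi / 2),
      Real.cos x ^ 2 / (p ^ 2 * Real.sin x ^ 2 + q ^ 2 * Real.cos x ^ 2) =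
      Real.pi / (q * (p + q)) := by
  have hpos : ∀ {a b : ℝ}, 0 < a → 0 < b → ∀ x : ℝ,
      0 < a * Real.sin x ^ 2 + b * Real.cos x ^ 2 := by
    intro a b ha hb x
    rcases lt_or_ge 0 (Real.sin x ^ 2) with h | h
    · positivity
    · have h1 : Real.sin x ^ 2 = 0 := le_antisymm h (sq_nonneg _)
      have h2 : Real.cos x ^ 2 = 1 := by linarith [Real.sin_sq_add_cos_sq x]
      rw [h1, h2]; linarith
  rcases eq_or_ne p q with rfl | hne
  · have : ∀ x : ℝ, Real.cos x ^ 2 / (p ^ 2 * Real.sin x ^ 2 + p ^ 2 * Real.cos x ^ 2) =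
        (p ^ 2)⁻¹ * Real.cos x ^ 2 := by
      intro x
      rw [← mul_add, Real.sin_sq_add_cos_sq]
      field_simp
    simp only [this, integral_const_mul, integral_cos_sq]
    simp
    field_simp
    ring
  have hsub : p - q ≠ 0 := sub_ne_zero.mpr hne
  have hder : ∀ x : ℝ, HasDerivAt (fun x =>
      (1 / (q * (p + q))) * x + p / (q * (p + q) * (p - q)) *
        Real.arctan ((p - q) * (Real.sin x * Real.cos x) /
          (p * Real.sin x ^ 2 + q * Real.cos x ^ 2)))
      (Real.cos x ^ 2 / (p ^ 2 * Real.sin x ^ 2 + q ^ 2 * Real.cos x ^ 2)) x := by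
    intro x
    have hs := Real.hasDerivAt_sin x
    have hc := Real.hasDerivAt_cos x
    have hd := hpos hp hq x
    have hd2 := hpos (pow_pos hp 2) (pow_pos hq 2) x
    have h1 := ((((hs.mul hc).const_mul (p - q)).div
      (((hs.pow 2).const_mul p).add ((hc.pow 2).const_mul q)) hd.ne').arctan.const_mul
        (p / (q * (p + q) * (p - q)))).add ((hasDerivAt_id x).const_mul (1 / (q * (p + q))))
    refine (h1.congr_deriv ?_).congr_of_eventuallyEq (.of_forall fun y => ?_)
    · simp only [Pi.add_apply, Pi.mul_apply, Pi.pow_apply, Pi.div_apply]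
      have hsc := Real.sin_sq_add_cos_sq x
      generalize Real.sin x = s at *
      generalize Real.cos x = c at *
      have hsum : (p * s ^ 2 + q * c ^ 2) ^ 2 + ((p - q) * (s * c)) ^ 2 =
          p ^ 2 * s ^ 2 + q ^ 2 * c ^ 2 := by
        linear_combination (p ^ 2 * s ^ 2 + q ^ 2 * c ^ 2) * hsc
      have hA : 1 / (1 + ((p - q) * (s * c) / (p * s ^ 2 + q * c ^ 2)) ^ 2) =
          (p * s ^ 2 + q * c ^ 2) ^ 2 / (p ^ 2 * s ^ 2 + q ^ 2 * c ^ 2) := by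
        rw [← hsum]
        field_simp
      rw [hA]
      have hpq : p + q ≠ 0 := by positivity
      have := hd.ne'
      have := hd2.ne'
      field_simp
      have hs2 : s ^ 2 = 1 - c ^ 2 := by linarith
      have hs4 : s ^ 4 = (1 - c ^ 2) ^ 2 := by rw [← hs2]; ring
      ring_nf
      simp only [hs2, hs4]
      ring
    · simp [add_comm]
  rw [integral_eq_sub_of_hasDerivAt (fun x _ => hder x)]
  · simp
    field_simp
    ring
  · apply Continuous.intervalIntegrable
    exact Continuous.div (by fun_prop) (by fun_prop)
      fun x => (hpos (pow_pos hp 2) (pow_pos hq 2) x).ne'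

theorem mul_arctan_eq_integral (w : ℝ) :
    Real.arctan w * w = ∫ s in (0 : ℝ)..1, w ^ 2 / (1 + (s * w) ^ 2) := by
  have hder : ∀ s : ℝ, HasDerivAt (fun s => w * Real.arctan (s * w))
      (w ^ 2 / (1 + (s * w) ^ 2)) s := by
    intro s
    refine (((hasDerivAt_id s).mul_const w).arctan.const_mul w).congr_deriv ?_
    simp only [id]
    ring
  rw [intervalIntegral.integral_eq_sub_of_hasDerivAt (fun s _ => hder s)]
  · simp [mul_comm]
  · apply Continuous.intervalIntegrable
    exact Continuous.div (by fun_prop) (by fun_prop) fun s => by positivity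

theorem integral_sq_div_sqrt_mul_sqrt_add_sqrt (k : ℝ) :
    ∫ s in (0 : ℝ)..1, k ^ 2 / (√(1 + k ^ 2 * s ^ 2) * (√(1 + k ^ 2) + √(1 + k ^ 2 * s ^ 2))) =
      Real.log (1 + k ^ 2) / 2 := by
  have hp : 0 < √(1 + k ^ 2) := by positivity
  have hpsq : √(1 + k ^ 2) ^ 2 = 1 + k ^ 2 := Real.sq_sqrt (by positivity)
  have hlog : Real.log (1 + k ^ 2) / 2 = Real.log √(1 + k ^ 2) :=
    (Real.log_sqrt (by positivity)).symm
  rw [hlog]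
  set p := √(1 + k ^ 2)
  have hk : k ^ 2 = p ^ 2 - 1 := by linarith
  have hpM : ∀ s : ℝ, 0 < (1 + √(1 + k ^ 2 * s ^ 2)) * (1 + p) + k ^ 2 * s ∧
      0 < (1 + √(1 + k ^ 2 * s ^ 2)) * (1 + p) - k ^ 2 * s := by
    intro s
    have hq : 0 < √(1 + k ^ 2 * s ^ 2) := by positivity
    have hqsq : √(1 + k ^ 2 * s ^ 2) ^ 2 = 1 + k ^ 2 * s ^ 2 := Real.sq_sqrt (by positivity)
    have h : |k ^ 2 * s| < (1 + √(1 + k ^ 2 * s ^ 2)) * (1 + p) := by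
      have h0 : |k ^ 2 * s| = |k| * |k * s| := by rw [← abs_mul]; ring_nf
      have h1 : |k| ≤ p := abs_le_of_sq_le_sq (by linarith) hp.le
      have h2 : |k * s| ≤ √(1 + k ^ 2 * s ^ 2) :=
        abs_le_of_sq_le_sq (by rw [hqsq]; linarith [mul_pow k s 2]) hq.le
      rw [h0]
      nlinarith [mul_le_mul h1 h2 (abs_nonneg _) hp.le]
    constructor <;> linarith [abs_lt.mp h]
  have hder : ∀ s : ℝ, HasDerivAt (fun s =>
      Real.log ((1 + √(1 + k ^ 2 * s ^ 2)) * (1 + p) + k ^ 2 * s) -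
        Real.log ((1 + √(1 + k ^ 2 * s ^ 2)) * (1 + p) - k ^ 2 * s))
      (k ^ 2 / (√(1 + k ^ 2 * s ^ 2) * (p + √(1 + k ^ 2 * s ^ 2)))) s := by
    intro s
    obtain ⟨hP, hM⟩ := hpM s
    have hpos : 0 < 1 + k ^ 2 * s ^ 2 := by positivity
    have hq : HasDerivAt (fun s => √(1 + k ^ 2 * s ^ 2)) (k ^ 2 * s / √(1 + k ^ 2 * s ^ 2)) s := by
      refine (((((hasDerivAt_id s).pow 2).const_mul (k ^ 2)).const_add 1).sqrt
        hpos.ne').congr_deriv ?_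
      simp
      field_simp
    have hl := (hasDerivAt_id s).const_mul (k ^ 2)
    have hb := (hq.const_add 1).mul_const (1 + p)
    refine (((hb.add hl).log hP.ne').sub ((hb.sub hl).log hM.ne')).congr_deriv ?_
    have hq0 : 0 < √(1 + k ^ 2 * s ^ 2) := by positivity
    have hqsq : √(1 + k ^ 2 * s ^ 2) ^ 2 = 1 + k ^ 2 * s ^ 2 := Real.sq_sqrt (by positivity)
    simp only [Pi.add_apply, Pi.sub_apply, id, mul_one]
    generalize √(1 + k ^ 2 * s ^ 2) = q at *
    have hPM : ((1 + q) * (1 + p) + k ^ 2 * s) * ((1 + q) * (1 + p) - k ^ 2 * s) =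
        2 * ((1 + q) * (1 + p) * (p + q)) := by
      linear_combination k ^ 2 * hqsq + (q ^ 2 - 1) * hpsq
    have hpq : p + q ≠ 0 := by positivity
    have h1q : 1 + q ≠ 0 := by positivity
    have h1p : 1 + p ≠ 0 := by positivity
    rw [div_sub_div _ _ hP.ne' hM.ne', hPM]
    field_simp
    linear_combination 2 * k ^ 2 * (1 + p) * hqsq
  rw [intervalIntegral.integral_eq_sub_of_hasDerivAt (fun s _ => hder s)]
  · have hp1 : √(1 + k ^ 2 * 1 ^ 2) = p := by simp [p]
    rw [hp1]
    have h1 : (1 + p) * (1 + p) + k ^ 2 * 1 = p * (2 * (1 + p)) := by rw [hk]; ring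
    have h2 : (1 + p) * (1 + p) - k ^ 2 * 1 = 2 * (1 + p) := by rw [hk]; ring
    rw [h1, h2, Real.log_mul (by positivity) (by positivity)]
    simp
  · apply Continuous.intervalIntegrable
    exact Continuous.div (by fun_prop) (by fun_prop) fun s => by positivity

theorem integral_arctan_sqrt_div_cosh_sq {k : ℝ} (hk : 0 < k) :
    ∫ u in (-Real.arsinh k)..Real.arsinh k,
      Real.arctan √((1 + k ^ 2) / Real.cosh u ^ 2 - 1) =
      Real.pi * (Real.log (1 + k ^ 2) / 2) := by
  have hsub := intervalIntegral.integral_comp_mul_deriv (a := -(Real.pi / 2)) (b := Real.pi / 2)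
    (f := fun x => Real.arsinh (k * Real.sin x))
    (f' := fun x => (√(1 + (k * Real.sin x) ^ 2))⁻¹ * (k * Real.cos x))
    (g := fun u => Real.arctan √((1 + k ^ 2) / Real.cosh u ^ 2 - 1))
    (fun x _ => by
      simpa using ((Real.hasDerivAt_sin x).const_mul k).arsinh)
    (Continuous.continuousOn (Continuous.mul (Continuous.inv₀ (by fun_prop)
      fun x => by positivity) (by fun_prop)))
    (Real.continuous_arctan.comp (Continuous.sqrt (Continuous.sub (Continuous.div
      continuous_const (by fun_prop) fun u => by positivity) continuous_const)))
  simp only [Real.sin_neg, Real.sin_pi_div_two, mul_neg, mul_one, Real.arsinh_neg] at hsub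
  rw [← hsub]
  have hden : ∀ s x : ℝ, 0 < √(1 + k ^ 2) ^ 2 * Real.sin x ^ 2 +
      √(1 + k ^ 2 * s ^ 2) ^ 2 * Real.cos x ^ 2 := by
    intro s x
    rw [Real.sq_sqrt (by positivity), Real.sq_sqrt (by positivity)]
    nlinarith [Real.sin_sq_add_cos_sq x, sq_nonneg (k * Real.sin x), sq_nonneg (k * s * Real.cos x)]
  have hpt : ∀ x ∈ Set.uIcc (-(Real.pi / 2)) (Real.pi / 2),
      ((fun u => Real.arctan √((1 + k ^ 2) / Real.cosh u ^ 2 - 1)) ∘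
        fun x => Real.arsinh (k * Real.sin x)) x *
          ((√(1 + (k * Real.sin x) ^ 2))⁻¹ * (k * Real.cos x)) =
      ∫ s in (0 : ℝ)..1, k ^ 2 * (Real.cos x ^ 2 / (√(1 + k ^ 2) ^ 2 * Real.sin x ^ 2 +
        √(1 + k ^ 2 * s ^ 2) ^ 2 * Real.cos x ^ 2)) := by
    intro x hx
    rw [Set.uIcc_of_le (by linarith [Real.pi_pos])] at hx
    have hc : 0 ≤ Real.cos x := Real.cos_nonneg_of_mem_Icc hx
    have hsc := Real.sin_sq_add_cos_sq x
    have hrpos : 0 < √(1 + (k * Real.sin x) ^ 2) := by positivity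
    have hrsq : √(1 + (k * Real.sin x) ^ 2) ^ 2 = 1 + (k * Real.sin x) ^ 2 :=
      Real.sq_sqrt (by positivity)
    have hw : √((1 + k ^ 2) / Real.cosh (Real.arsinh (k * Real.sin x)) ^ 2 - 1) =
        (√(1 + (k * Real.sin x) ^ 2))⁻¹ * (k * Real.cos x) := by
      rw [Real.cosh_arsinh, ← Real.sqrt_sq (show 0 ≤ (√(1 + (k * Real.sin x) ^ 2))⁻¹ * (k * Real.cos x) by positivity)]
      congr 1
      rw [mul_pow _ (k * Real.cos x), inv_pow, hrsq]
      field_simp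
      linear_combination (-k ^ 2) * hsc
    simp only [Function.comp]
    rw [hw, mul_arctan_eq_integral]
    refine intervalIntegral.integral_congr fun s _ => ?_
    have hd := hden s x
    rw [Real.sq_sqrt (by positivity), Real.sq_sqrt (by positivity)] at hd ⊢
    generalize √(1 + (k * Real.sin x) ^ 2) = r at *
    have hE : 1 + (s * (r⁻¹ * (k * Real.cos x))) ^ 2 =
        ((1 + k ^ 2) * Real.sin x ^ 2 + (1 + k ^ 2 * s ^ 2) * Real.cos x ^ 2) / r ^ 2 := by
      field_simp
      linear_combination hrsq - hsc
    rw [hE]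
    have := hd.ne'
    field_simp
  rw [intervalIntegral.integral_congr hpt, MeasureTheory.intervalIntegral_intervalIntegral_swap]
  · have : ∀ s : ℝ, ∫ x in (-(Real.pi / 2))..(Real.pi / 2),
        k ^ 2 * (Real.cos x ^ 2 / (√(1 + k ^ 2) ^ 2 * Real.sin x ^ 2 +
          √(1 + k ^ 2 * s ^ 2) ^ 2 * Real.cos x ^ 2)) =
        Real.pi * (k ^ 2 / (√(1 + k ^ 2 * s ^ 2) * (√(1 + k ^ 2) + √(1 + k ^ 2 * s ^ 2)))) := by
      intro s
      rw [intervalIntegral.integral_const_mul,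
        integral_cos_sq_div_mul_sin_sq_add_mul_cos_sq (by positivity) (by positivity)]
      ring
    simp only [this]
    rw [intervalIntegral.integral_const_mul, integral_sq_div_sqrt_mul_sqrt_add_sqrt]
  · refine (Continuous.continuousOn ?_).integrableOn_compact
      (isCompact_uIcc.prod isCompact_uIcc) |>.mono_set
        (Set.prod_mono Set.uIoc_subset_uIcc Set.uIoc_subset_uIcc)
    exact continuous_const.mul (Continuous.div (by fun_prop) (by fun_prop)
      fun z => (hden z.2 z.1).ne')

/-- The one-cut saddle-point density of q-deformed Yang–Mills theory on S² is a
probability density: with `b = (2/t)·arccosh(e^{t²/(2a)})` (here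
`arccosh x = log (x + √(x²−1))`) and
`ρ(z) = (a/(πt))·arctan √(e^{t²/a}/cosh²(tz/2) − 1)`, one has `∫_{−b}^b ρ = 1`. -/
theorem qYM_one_cut_density_normalized (t a : ℝ) (ht : 0 < t) (ha : 0 < a) :
    (∫ z in (-((2 / t) * Real.log (Real.exp (t ^ 2 / (2 * a)) +
        Real.sqrt ((Real.exp (t ^ 2 / (2 * a))) ^ 2 - 1))))..(
      (2 / t) * Real.log (Real.exp (t ^ 2 / (2 * a)) +
        Real.sqrt ((Real.exp (t ^ 2 / (2 * a))) ^ 2 - 1))),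
      (a / (Real.pi * t)) *
        Real.arctan (Real.sqrt (Real.exp (t ^ 2 / a) / (Real.cosh (t * z / 2)) ^ 2 - 1)))
    = 1 := by
  set C := Real.exp (t ^ 2 / (2 * a)) with hC
  have hC1 : 1 < C := Real.one_lt_exp_iff.mpr (by positivity)
  have hCsq : Real.exp (t ^ 2 / a) = C ^ 2 := by
    rw [hC, ← Real.exp_nat_mul]
    congr 1
    field_simp
    norm_num
  have hk : 0 < √(C ^ 2 - 1) := Real.sqrt_pos.mpr (by nlinarith)
  have hksq : 1 + √(C ^ 2 - 1) ^ 2 = C ^ 2 := by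
    rw [Real.sq_sqrt (by nlinarith)]
    ring
  have hU : Real.log (C + √(C ^ 2 - 1)) = Real.arsinh √(C ^ 2 - 1) := by
    rw [Real.arsinh, hksq, Real.sqrt_sq (by linarith), add_comm]
  have hint := integral_arctan_sqrt_div_cosh_sq hk
  rw [hksq, Real.log_pow, hC, Real.log_exp] at hint
  rw [hU, hCsq, intervalIntegral.integral_const_mul]
  have hscale := intervalIntegral.integral_comp_mul_left
    (a := -(2 / t * Real.arsinh √(C ^ 2 - 1))) (b := 2 / t * Real.arsinh √(C ^ 2 - 1))
    (fun u => Real.arctan √(C ^ 2 / Real.cosh u ^ 2 - 1)) (c := t / 2) (by positivity)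
  have e1 : t / 2 * (2 / t * Real.arsinh √(C ^ 2 - 1)) = Real.arsinh √(C ^ 2 - 1) := by
    field_simp
  rw [mul_neg, e1, hint, smul_eq_mul] at hscale
  simp only [mul_div_right_comm t _ 2]
  rw [hscale]
  have := Real.pi_pos.ne'
  field_simp
  norm_num
end

section
/- For all real t, a > 0, the second moment of the one-cut density is ∫_{−b}^{b} z² ρ(z) dz = t²/(3a²) + π²/(3t²) − (4a/t⁴)·ζ(3) + (2/t²)·Li₂(e^{−t²/a}) + (4a/t⁴)·Li₃(e^{−t²/a}), where ζ(3) = Σ_{n≥1} 1/n³. -/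
open Real Set MeasureTheory intervalIntegral

attribute [fun_prop] Real.continuous_arsinh

theorem hasDerivAt_integral_comp_mul_sin {Φ Φ' : ℝ → ℝ} (hΦ : ∀ w, HasDerivAt Φ (Φ' w) w)
    (hΦ' : Continuous Φ') (α β k : ℝ) :
    HasDerivAt (fun k => ∫ θ in α..β, Φ (k * sin θ))
      (∫ θ in α..β, Φ' (k * sin θ) * sin θ) k := by
  have hc : Continuous Φ := continuous_iff_continuousAt.2 fun w => (hΦ w).continuousAt
  obtain ⟨C, hC⟩ := (isCompact_Icc (a := -(|k| + 1)) (b := |k| + 1)).exists_bound_of_continuousOn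
    hΦ'.continuousOn
  refine (intervalIntegral.hasDerivAt_integral_of_dominated_loc_of_deriv_le (s := Metric.ball k 1)
    (bound := fun _ => C) (F := fun k θ => Φ (k * sin θ))
    (F' := fun k θ => Φ' (k * sin θ) * sin θ)
    (Metric.ball_mem_nhds k one_pos) ?_ ?_ ?_ ?_ ?_ ?_).2
  · exact Filter.Eventually.of_forall fun x =>
      (by fun_prop : Continuous fun θ => Φ (x * sin θ)).aestronglyMeasurable
  · exact (by fun_prop : Continuous fun θ => Φ (k * sin θ)).intervalIntegrable _ _
  · exact (by fun_prop : Continuous fun θ => Φ' (k * sin θ) * sin θ).aestronglyMeasurable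
  · refine Filter.Eventually.of_forall fun θ _ x hx => ?_
    have hx1 : |x| ≤ |k| + 1 := by
      have h1 := abs_sub_abs_le_abs_sub x k
      have h2 : |x - k| < 1 := by simpa [Real.dist_eq] using hx
      linarith
    have hm : |x * sin θ| ≤ |k| + 1 := by
      rw [abs_mul]
      exact (mul_le_of_le_one_right (abs_nonneg x) (abs_sin_le_one θ)).trans hx1
    have := hC _ (abs_le.1 hm)
    rw [norm_mul]
    exact (mul_le_of_le_one_right (norm_nonneg _) (abs_sin_le_one θ)).trans this
  · exact intervalIntegrable_const
  · refine Filter.Eventually.of_forall fun θ _ x _ => ?_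
    have h := (hΦ (x * sin θ)).comp x ((hasDerivAt_id x).mul_const (sin θ))
    rw [one_mul] at h
    exact h

theorem hasDerivAt_arsinh_pow_div_sqrt (n : ℕ) (w : ℝ) :
    HasDerivAt (fun w => arsinh w ^ (n + 1) / √(1 + w ^ 2))
      ((n + 1) * arsinh w ^ n / (1 + w ^ 2) - arsinh w ^ (n + 1) * w / √(1 + w ^ 2) ^ 3) w := by
  have hp : 0 < 1 + w ^ 2 := by positivity
  have hs : 0 < √(1 + w ^ 2) := sqrt_pos.2 hp
  have h1 := ((hasDerivAt_arsinh w).pow (n + 1))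
  have h2 := (((hasDerivAt_id w).pow 2).const_add 1).sqrt hp.ne'
  refine (h1.div h2 hs.ne').congr_deriv ?_
  have hq : 1 + w ^ 2 = √(1 + w ^ 2) ^ 2 := (sq_sqrt hp.le).symm
  simp only [id, Pi.pow_apply]
  generalize √(1 + w ^ 2) = c at *
  rw [hq]
  push_cast
  field_simp

theorem hasDerivAt_arsinh_pow_mul_div_sqrt (n : ℕ) (w : ℝ) :
    HasDerivAt (fun w => arsinh w ^ (n + 1) / √(1 + w ^ 2) * w)
      ((n + 1) * arsinh w ^ n * w / (1 + w ^ 2) + arsinh w ^ (n + 1) / √(1 + w ^ 2) ^ 3) w := by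
  have hp : 0 < 1 + w ^ 2 := by positivity
  have hs : 0 < √(1 + w ^ 2) := sqrt_pos.2 hp
  refine ((hasDerivAt_arsinh_pow_div_sqrt n w).mul (hasDerivAt_id w)).congr_deriv ?_
  have hq : 1 + w ^ 2 = √(1 + w ^ 2) ^ 2 := (sq_sqrt hp.le).symm
  simp only [id]
  generalize √(1 + w ^ 2) = c at *
  rw [hq]
  have : w ^ 2 = c ^ 2 - 1 := by linarith
  field_simp
  linear_combination (-arsinh w * arsinh w ^ n) * this

theorem hasDerivAt_integral_arsinh_pow_mul_div_sqrt (n : ℕ) (k : ℝ) :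
    HasDerivAt (fun k => ∫ θ in (-(π / 2))..(π / 2),
        arsinh (k * sin θ) ^ (n + 1) / √(1 + (k * sin θ) ^ 2) * (k * sin θ))
      ((n + 1) * k / (1 + k ^ 2) * ∫ θ in (-(π / 2))..(π / 2), arsinh (k * sin θ) ^ n) k := by
  have hne : ∀ x : ℝ, √(1 + x ^ 2) ≠ 0 := fun x => (sqrt_pos.2 (by positivity)).ne'
  have hne' : ∀ x : ℝ, 1 + x ^ 2 ≠ 0 := fun x => by positivity
  refine (hasDerivAt_integral_comp_mul_sin (hasDerivAt_arsinh_pow_mul_div_sqrt n) ?_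
    _ _ k).congr_deriv ?_
  · fun_prop (disch := intros; first | exact hne _ | exact hne' _ | exact pow_ne_zero _ (hne _))
  set B' : ℝ → ℝ := fun θ =>
    -sin θ * (arsinh (k * sin θ) ^ (n + 1) / √(1 + (k * sin θ) ^ 2)) +
    cos θ * (((n + 1) * arsinh (k * sin θ) ^ n / (1 + (k * sin θ) ^ 2) -
      arsinh (k * sin θ) ^ (n + 1) * (k * sin θ) / √(1 + (k * sin θ) ^ 2) ^ 3) * (k * cos θ))
    with hB'
  have hcont : Continuous B' := by
    fun_prop (disch := intros; first | exact hne _ | exact hne' _ | exact pow_ne_zero _ (hne _))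
  have hint : ∫ θ in (-(π / 2))..(π / 2), B' θ = 0 := by
    rw [integral_eq_sub_of_hasDerivAt (f := fun θ => cos θ *
      (arsinh (k * sin θ) ^ (n + 1) / √(1 + (k * sin θ) ^ 2))) (fun θ _ => ?_)
      (hcont.intervalIntegrable _ _)]
    · simp
    · have h := (hasDerivAt_arsinh_pow_div_sqrt n (k * sin θ)).comp θ
        ((hasDerivAt_sin θ).const_mul k)
      exact (hasDerivAt_cos θ).mul h
  have hA : Continuous fun θ => arsinh (k * sin θ) ^ n := by fun_prop
  have key : ∀ θ, ((n + 1) * arsinh (k * sin θ) ^ n * (k * sin θ) / (1 + (k * sin θ) ^ 2) +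
      arsinh (k * sin θ) ^ (n + 1) / √(1 + (k * sin θ) ^ 2) ^ 3) * sin θ =
      (n + 1) * k / (1 + k ^ 2) * arsinh (k * sin θ) ^ n - (1 + k ^ 2)⁻¹ * B' θ := by
    intro θ
    have hp : 0 < 1 + (k * sin θ) ^ 2 := by positivity
    have hs : 0 < √(1 + (k * sin θ) ^ 2) := sqrt_pos.2 hp
    have hq : 1 + (k * sin θ) ^ 2 = √(1 + (k * sin θ) ^ 2) ^ 2 := (sq_sqrt hp.le).symm
    have hk : (1 + k ^ 2) ≠ 0 := hne' k
    simp only [hB']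
    generalize arsinh (k * sin θ) = u at *
    generalize √(1 + (k * sin θ) ^ 2) = c at *
    rw [hq]
    have hcos := cos_sq' θ
    generalize sin θ = s at *
    generalize cos θ = x at *
    field_simp
    linear_combination (n + 1) * u ^ n * c * k * (hq + hcos) +
      u ^ (n + 1) * s * (hq - k ^ 2 * hcos)
  simp_rw [key]
  rw [intervalIntegral.integral_sub ((hA.const_mul _).intervalIntegrable _ _)
    ((hcont.const_mul _).intervalIntegrable _ _)]
  simp [hint]

theorem eqOn_Ici_of_hasDerivAt {f g f' : ℝ → ℝ} {a : ℝ} (hf : ContinuousOn f (Ici a))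
    (hg : ContinuousOn g (Ici a)) (hf' : ∀ x, a < x → HasDerivAt f (f' x) x)
    (hg' : ∀ x, a < x → HasDerivAt g (f' x) x) (h : f a = g a) : EqOn f g (Ici a) := by
  intro x hx
  rcases (mem_Ici.1 hx).eq_or_lt with rfl | hx
  · exact h
  obtain ⟨c, hc, he⟩ := exists_hasDerivAt_eq_slope (fun y => f y - g y) (fun y => f' y - f' y) hx
    ((hf.sub hg).mono Icc_subset_Ici_self) fun y hy => (hf' y hy.1).sub (hg' y hy.1)
  have hx' : x - a ≠ 0 := by linarith
  simp only [sub_self] at he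
  rw [eq_div_iff hx'] at he
  linarith

theorem summable_one_div_add_one_sq : Summable fun n : ℕ => 1 / ((n : ℝ) + 1) ^ 2 := by
  have := (summable_nat_add_iff 1).2 hasSum_zeta_two.summable
  simpa using this

theorem tsum_one_div_add_one_sq : ∑' n : ℕ, 1 / ((n : ℝ) + 1) ^ 2 = π ^ 2 / 6 := by
  have := hasSum_zeta_two.summable.tsum_eq_zero_add
  rw [hasSum_zeta_two.tsum_eq] at this
  simpa using this.symm

theorem mul_exp_neg_mul_le {m s : ℝ} (hm : 0 < m) : s * exp (-(m * s)) ≤ 1 / m := by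
  have h1 := add_one_le_exp (m * s)
  have h2 := exp_pos (-(m * s))
  have h3 : exp (-(m * s)) * exp (m * s) = 1 := by rw [← exp_add]; simp
  rw [le_div_iff₀ hm]
  nlinarith

/-- The general term of `Li₂(e⁻ˢ) / 2 - s / 2 * log (1 - e⁻ˢ)`. -/
noncomputable def dilogTerm (n : ℕ) (s : ℝ) : ℝ :=
  exp (-((n + 1) * s)) / (n + 1) ^ 2 / 2 + s * exp (-((n + 1) * s)) / (n + 1) / 2

/-- The general term of `s / 2 * Li₂(e⁻ˢ) + Li₃(e⁻ˢ)`. -/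
noncomputable def trilogTerm (n : ℕ) (s : ℝ) : ℝ :=
  s * exp (-((n + 1) * s)) / (n + 1) ^ 2 / 2 + exp (-((n + 1) * s)) / (n + 1) ^ 3

theorem norm_dilogTerm_le (n : ℕ) {s : ℝ} (hs : 0 ≤ s) :
    ‖dilogTerm n s‖ ≤ 1 / ((n : ℝ) + 1) ^ 2 := by
  have hm : (0 : ℝ) < n + 1 := by positivity
  rw [norm_of_nonneg (by unfold dilogTerm; positivity), dilogTerm]
  have h1 : exp (-((n + 1) * s)) ≤ 1 := exp_le_one_iff.2 (by nlinarith)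
  have h2 := mul_exp_neg_mul_le (s := s) hm
  have h3 : exp (-((n + 1) * s)) / ((n : ℝ) + 1) ^ 2 ≤ 1 / ((n : ℝ) + 1) ^ 2 := by gcongr
  have h4 : s * exp (-((n + 1) * s)) / ((n : ℝ) + 1) ≤ 1 / ((n : ℝ) + 1) / ((n : ℝ) + 1) := by
    gcongr
  rw [div_div, ← sq] at h4
  linarith

theorem norm_trilogTerm_le (n : ℕ) {s : ℝ} (hs : 0 ≤ s) :
    ‖trilogTerm n s‖ ≤ 2 * (1 / ((n : ℝ) + 1) ^ 2) := by
  have hm : (0 : ℝ) < n + 1 := by positivity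
  have hm1 : (1 : ℝ) ≤ n + 1 := by simp
  rw [norm_of_nonneg (by unfold trilogTerm; positivity), trilogTerm]
  have h1 : exp (-((n + 1) * s)) ≤ 1 := exp_le_one_iff.2 (by nlinarith)
  have h2 : s * exp (-((n + 1) * s)) ≤ 1 :=
    (mul_exp_neg_mul_le (s := s) hm).trans ((div_le_one hm).2 hm1)
  have h3 : s * exp (-((n + 1) * s)) / ((n : ℝ) + 1) ^ 2 ≤ 1 / ((n : ℝ) + 1) ^ 2 := by gcongr
  have h4 : exp (-((n + 1) * s)) / ((n : ℝ) + 1) ^ 3 ≤ 1 / ((n : ℝ) + 1) ^ 2 := by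
    gcongr
    norm_num
  have h5 : 0 ≤ 1 / ((n : ℝ) + 1) ^ 2 := by positivity
  linarith

theorem hasDerivAt_exp_neg_mul (m s : ℝ) :
    HasDerivAt (fun s => exp (-(m * s))) (-m * exp (-(m * s))) s := by
  have h := ((hasDerivAt_id s).const_mul m).neg.exp
  exact h.congr_deriv (by simp; ring)

theorem hasDerivAt_dilogTerm (n : ℕ) (s : ℝ) :
    HasDerivAt (dilogTerm n) (-(s * exp (-((n + 1) * s)) / 2)) s := by
  have hm : (n + 1 : ℝ) ≠ 0 := by positivity
  have h := hasDerivAt_exp_neg_mul (n + 1) s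
  refine (((h.div_const ((n + 1) ^ 2)).div_const 2).add
    ((((hasDerivAt_id s).mul h).div_const (n + 1)).div_const 2)).congr_deriv ?_
  simp only [id]
  field_simp
  ring

theorem hasDerivAt_trilogTerm (n : ℕ) (s : ℝ) :
    HasDerivAt (trilogTerm n) (-dilogTerm n s) s := by
  have hm : (n + 1 : ℝ) ≠ 0 := by positivity
  have h := hasDerivAt_exp_neg_mul (n + 1) s
  refine (((((hasDerivAt_id s).mul h).div_const ((n + 1) ^ 2)).div_const 2).add
    (h.div_const ((n + 1) ^ 3))).congr_deriv ?_
  simp only [id, dilogTerm]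
  field_simp
  ring

theorem continuousOn_tsum_dilogTerm : ContinuousOn (fun s => ∑' n, dilogTerm n s) (Ici 0) :=
  continuousOn_tsum (fun n s _ => (hasDerivAt_dilogTerm n s).continuousAt.continuousWithinAt)
    summable_one_div_add_one_sq fun n _ hs => norm_dilogTerm_le n hs

theorem continuousOn_tsum_trilogTerm : ContinuousOn (fun s => ∑' n, trilogTerm n s) (Ici 0) :=
  continuousOn_tsum (fun n s _ => (hasDerivAt_trilogTerm n s).continuousAt.continuousWithinAt)
    (summable_one_div_add_one_sq.mul_left 2) fun n _ hs => norm_trilogTerm_le n hs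

theorem hasDerivAt_tsum_trilogTerm {s : ℝ} (hs : 0 < s) :
    HasDerivAt (fun s => ∑' n, trilogTerm n s) (-∑' n, dilogTerm n s) s := by
  rw [← tsum_neg]
  refine hasDerivAt_tsum_of_isPreconnected summable_one_div_add_one_sq isOpen_Ioi
    isPreconnected_Ioi (fun n y _ => hasDerivAt_trilogTerm n y) (fun n y hy => ?_)
    (mem_Ioi.2 hs) ?_ (mem_Ioi.2 hs)
  · rw [norm_neg]
    exact norm_dilogTerm_le n (mem_Ioi.1 hy).le
  · exact .of_norm_bounded (summable_one_div_add_one_sq.mul_left 2)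
      fun n => norm_trilogTerm_le n hs.le

theorem hasSum_exp_neg_add_one_mul {s : ℝ} (hs : 0 < s) :
    HasSum (fun n : ℕ => exp (-((n + 1) * s))) (exp (-s) * (1 - exp (-s))⁻¹) := by
  have h := (hasSum_geometric_of_lt_one (exp_pos (-s)).le (exp_lt_one_iff.2 (neg_lt_zero.2 hs))).mul_left
    (exp (-s))
  convert! h using 2 with n
  rw [← exp_nat_mul, ← exp_add]
  ring_nf

theorem hasDerivAt_tsum_dilogTerm {s : ℝ} (hs : 0 < s) :
    HasDerivAt (fun s => ∑' n, dilogTerm n s) (-(s / 2 * (exp (-s) * (1 - exp (-s))⁻¹))) s := by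
  have hmem : s ∈ Ioo (s / 2) (2 * s) := ⟨by linarith, by linarith⟩
  have h := hasDerivAt_tsum_of_isPreconnected
    ((hasSum_exp_neg_add_one_mul (half_pos hs)).summable.mul_left s) isOpen_Ioo
    isPreconnected_Ioo (fun n y _ => hasDerivAt_dilogTerm n y) (fun n y hy => ?_) hmem
    (.of_norm_bounded summable_one_div_add_one_sq fun n => norm_dilogTerm_le n hs.le) hmem
  · refine h.congr_deriv ?_
    rw [tsum_neg, ← (hasSum_exp_neg_add_one_mul hs).tsum_eq, ← tsum_mul_left]
    congr 2 with n
    ring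
  · have hy0 : 0 < y := (half_pos hs).trans hy.1
    rw [norm_neg, norm_of_nonneg (by positivity), mul_div_right_comm]
    have h1 : y / 2 ≤ s := by linarith [hy.2]
    have h2 := hy.1.le
    gcongr

theorem hasDerivAt_sqrt_exp_sub_one {s : ℝ} (hs : 0 < s) :
    HasDerivAt (fun s => √(exp s - 1)) (exp s / (2 * √(exp s - 1))) s :=
  ((hasDerivAt_exp s).sub_const 1).sqrt (sub_pos.2 (one_lt_exp_iff.2 hs)).ne'

theorem hasDerivAt_integral_arsinh_sq (k : ℝ) (hk : k ≠ 0) :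
    HasDerivAt (fun k => ∫ θ in (-(π / 2))..(π / 2), arsinh (k * sin θ) ^ 2)
      (2 / k * ∫ θ in (-(π / 2))..(π / 2),
        arsinh (k * sin θ) ^ (0 + 1) / √(1 + (k * sin θ) ^ 2) * (k * sin θ)) k := by
  have hne : ∀ x : ℝ, √(1 + x ^ 2) ≠ 0 := fun x => (sqrt_pos.2 (by positivity)).ne'
  have h : ∀ w, HasDerivAt (fun w => arsinh w ^ 2) (2 * arsinh w / √(1 + w ^ 2)) w := fun w =>
    ((hasDerivAt_arsinh w).pow 2).congr_deriv (by simp [div_eq_mul_inv])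
  refine (hasDerivAt_integral_comp_mul_sin h (by fun_prop (disch := intros; exact hne _))
    _ _ k).congr_deriv ?_
  rw [← intervalIntegral.integral_const_mul]
  congr 1 with θ
  field_simp
  simp

theorem continuous_integral_arsinh_pow_mul_div_sqrt (n : ℕ) :
    Continuous fun k => ∫ θ in (-(π / 2))..(π / 2),
        arsinh (k * sin θ) ^ (n + 1) / √(1 + (k * sin θ) ^ 2) * (k * sin θ) :=
  continuous_iff_continuousAt.2 fun k =>
    (hasDerivAt_integral_arsinh_pow_mul_div_sqrt n k).continuousAt

theorem continuous_integral_arsinh_pow (n : ℕ) :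
    Continuous fun k => ∫ θ in (-(π / 2))..(π / 2), arsinh (k * sin θ) ^ n :=
  intervalIntegral.continuous_parametric_intervalIntegral_of_continuous' (by fun_prop) _ _

theorem hasDerivAt_integral_arsinh_pow_mul_div_sqrt_exp (n : ℕ) {s : ℝ} (hs : 0 < s) :
    HasDerivAt (fun s => ∫ θ in (-(π / 2))..(π / 2),
        arsinh (√(exp s - 1) * sin θ) ^ (n + 1) / √(1 + (√(exp s - 1) * sin θ) ^ 2) *
          (√(exp s - 1) * sin θ))
      ((n + 1) / 2 * ∫ θ in (-(π / 2))..(π / 2), arsinh (√(exp s - 1) * sin θ) ^ n) s := by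
  have he : 0 < exp s - 1 := sub_pos.2 (one_lt_exp_iff.2 hs)
  have h := (hasDerivAt_integral_arsinh_pow_mul_div_sqrt n (√(exp s - 1))).comp s
    (hasDerivAt_sqrt_exp_sub_one hs)
  refine h.congr_deriv ?_
  have hk := sqrt_pos.2 he
  rw [sq_sqrt he.le]
  have := exp_pos s
  field_simp
  ring

theorem integral_arsinh_mul_div_sqrt_exp {s : ℝ} (hs : 0 ≤ s) :
    ∫ θ in (-(π / 2))..(π / 2), arsinh (√(exp s - 1) * sin θ) ^ (0 + 1) /
      √(1 + (√(exp s - 1) * sin θ) ^ 2) * (√(exp s - 1) * sin θ) = π / 2 * s := by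
  refine eqOn_Ici_of_hasDerivAt (f' := fun _ => π / 2) (g := fun s => π / 2 * s) ?_ (by fun_prop)
    (fun x hx => (hasDerivAt_integral_arsinh_pow_mul_div_sqrt_exp 0 hx).congr_deriv ?_)
    (fun x _ => ?_) ?_ (mem_Ici.2 hs)
  · exact ((continuous_integral_arsinh_pow_mul_div_sqrt 0).comp
      (f := fun s => √(exp s - 1)) (by fun_prop)).continuousOn
  · simp; ring
  · simpa using (hasDerivAt_id x).const_mul (π / 2)
  · simp

theorem integral_arsinh_sq_exp {s : ℝ} (hs : 0 ≤ s) :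
    ∫ θ in (-(π / 2))..(π / 2), arsinh (√(exp s - 1) * sin θ) ^ 2 =
      π * (s ^ 2 / 4 + π ^ 2 / 12 - ∑' n, dilogTerm n s) := by
  refine eqOn_Ici_of_hasDerivAt (f' := fun s => π * (s / 2 * (1 - exp (-s))⁻¹))
    (f := fun s => ∫ θ in (-(π / 2))..(π / 2), arsinh (√(exp s - 1) * sin θ) ^ 2)
    (g := fun s => π * (s ^ 2 / 4 + π ^ 2 / 12 - ∑' n, dilogTerm n s)) ?_ ?_
    (fun x hx => ?_) (fun x hx => ?_) ?_ (mem_Ici.2 hs)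
  · exact ((continuous_integral_arsinh_pow 2).comp
      (f := fun s => √(exp s - 1)) (by fun_prop)).continuousOn
  · exact ((by fun_prop : Continuous fun s : ℝ => s ^ 2 / 4 + π ^ 2 / 12).continuousOn.sub
      continuousOn_tsum_dilogTerm).const_mul π
  · have he : 0 < exp x - 1 := sub_pos.2 (one_lt_exp_iff.2 hx)
    have hk := sqrt_pos.2 he
    have h := (hasDerivAt_integral_arsinh_sq _ hk.ne').comp x (hasDerivAt_sqrt_exp_sub_one hx)
    refine h.congr_deriv ?_
    rw [integral_arsinh_mul_div_sqrt_exp hx.le, exp_neg]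
    have hq := sq_sqrt he.le
    have := exp_pos x
    have h1 : 1 - (exp x)⁻¹ = √(exp x - 1) ^ 2 / exp x := by rw [hq]; field_simp
    rw [h1]
    field_simp
  · have he : 0 < 1 - exp (-x) := sub_pos.2 (exp_lt_one_iff.2 (neg_lt_zero.2 hx))
    refine (((((hasDerivAt_id x).pow 2).div_const 4).add_const (π ^ 2 / 12)).sub
      (hasDerivAt_tsum_dilogTerm hx)).const_mul π |>.congr_deriv ?_
    simp only [id]
    field_simp
    norm_num
    ring
  · have : ∀ n, dilogTerm n 0 = 1 / ((n : ℝ) + 1) ^ 2 / 2 := fun n => by simp [dilogTerm]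
    simp only [this, tsum_div_const, tsum_one_div_add_one_sq]
    simp
    ring

theorem integral_arsinh_cube_mul_div_sqrt_exp {s : ℝ} (hs : 0 ≤ s) :
    ∫ θ in (-(π / 2))..(π / 2), arsinh (√(exp s - 1) * sin θ) ^ (2 + 1) /
      √(1 + (√(exp s - 1) * sin θ) ^ 2) * (√(exp s - 1) * sin θ) =
      3 * π / 2 * (s ^ 3 / 12 + π ^ 2 * s / 12 - ∑' n : ℕ, 1 / ((n : ℝ) + 1) ^ 3 +
        ∑' n, trilogTerm n s) := by
  refine eqOn_Ici_of_hasDerivAt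
    (f' := fun s => 3 * π / 2 * (s ^ 2 / 4 + π ^ 2 / 12 - ∑' n, dilogTerm n s))
    (g := fun s => 3 * π / 2 * (s ^ 3 / 12 + π ^ 2 * s / 12 - ∑' n : ℕ, 1 / ((n : ℝ) + 1) ^ 3 +
        ∑' n, trilogTerm n s)) ?_ ?_
    (fun x hx => (hasDerivAt_integral_arsinh_pow_mul_div_sqrt_exp 2 hx).congr_deriv ?_)
    (fun x hx => ?_) ?_ (mem_Ici.2 hs)
  · exact ((continuous_integral_arsinh_pow_mul_div_sqrt 2).comp
      (f := fun s => √(exp s - 1)) (by fun_prop)).continuousOn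
  · exact ((by fun_prop : Continuous fun s : ℝ => s ^ 3 / 12 + π ^ 2 * s / 12 -
      ∑' n : ℕ, 1 / ((n : ℝ) + 1) ^ 3).continuousOn.add continuousOn_tsum_trilogTerm).const_mul _
  · rw [integral_arsinh_sq_exp hx.le]
    push_cast
    ring
  · refine ((((((hasDerivAt_id x).pow 3).div_const 12).add
      (((hasDerivAt_id x).const_mul (π ^ 2)).div_const 12)).sub_const _).add
      (hasDerivAt_tsum_trilogTerm hx)).const_mul (3 * π / 2) |>.congr_deriv ?_
    simp only [id]
    norm_num
    ring
  · simp [trilogTerm]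

theorem hasDerivAt_arctan_mul_cos_div_sqrt (k θ : ℝ) :
    HasDerivAt (fun θ => arctan (k * cos θ / √(1 + (k * sin θ) ^ 2)))
      (-(k * sin θ / √(1 + (k * sin θ) ^ 2))) θ := by
  have hp : 0 < 1 + (k * sin θ) ^ 2 := by positivity
  have hs : 0 < √(1 + (k * sin θ) ^ 2) := sqrt_pos.2 hp
  have h := (((hasDerivAt_cos θ).const_mul k).div
    (((((hasDerivAt_sin θ).const_mul k).pow 2).const_add 1).sqrt hp.ne') hs.ne').arctan
  refine h.congr_deriv ?_
  have hq : √(1 + (k * sin θ) ^ 2) ^ 2 = 1 + (k * sin θ) ^ 2 := sq_sqrt hp.le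
  have hcos := cos_sq' θ
  simp only [Pi.div_apply, Pi.pow_apply]
  generalize √(1 + (k * sin θ) ^ 2) = c at *
  generalize sin θ = y at *
  generalize cos θ = x at *
  have hd : c ^ 2 + (k * x) ^ 2 ≠ 0 := by positivity
  have hd' : 1 + (k * x / c) ^ 2 ≠ 0 := by positivity
  field_simp
  push_cast
  ring

theorem sqrt_div_cosh_arsinh_sq_sub_one {k θ : ℝ} (hk : 0 ≤ k) (hθ : 0 ≤ cos θ) :
    √((1 + k ^ 2) / cosh (arsinh (k * sin θ)) ^ 2 - 1) =
      k * cos θ / √(1 + (k * sin θ) ^ 2) := by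
  have hp : 0 < 1 + (k * sin θ) ^ 2 := by positivity
  have h : (1 + k ^ 2) / (1 + (k * sin θ) ^ 2) - 1 = (k * cos θ) ^ 2 / (1 + (k * sin θ) ^ 2) := by
    rw [div_sub_one hp.ne', mul_pow k (cos θ), cos_sq']
    ring
  rw [cosh_arsinh, sq_sqrt hp.le, h, sqrt_div (sq_nonneg _), sqrt_sq (mul_nonneg hk hθ)]

theorem integral_arsinh_sq_mul_arctan (k : ℝ) :
    ∫ θ in (-(π / 2))..(π / 2), arsinh (k * sin θ) ^ 2 *
      arctan (k * cos θ / √(1 + (k * sin θ) ^ 2)) * ((√(1 + (k * sin θ) ^ 2))⁻¹ * (k * cos θ)) =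
    1 / 3 * ∫ θ in (-(π / 2))..(π / 2),
      arsinh (k * sin θ) ^ (2 + 1) / √(1 + (k * sin θ) ^ 2) * (k * sin θ) := by
  have hne : ∀ x : ℝ, √(1 + x ^ 2) ≠ 0 := fun x => (sqrt_pos.2 (by positivity)).ne'
  have h1 : Continuous fun θ => arsinh (k * sin θ) ^ 2 *
      arctan (k * cos θ / √(1 + (k * sin θ) ^ 2)) *
        ((√(1 + (k * sin θ) ^ 2))⁻¹ * (k * cos θ)) := by
    fun_prop (disch := intros; exact hne _)
  have h2 : Continuous fun θ =>
      arsinh (k * sin θ) ^ (2 + 1) / √(1 + (k * sin θ) ^ 2) * (k * sin θ) := by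
    fun_prop (disch := intros; exact hne _)
  rw [← intervalIntegral.integral_const_mul, ← sub_eq_zero,
    ← intervalIntegral.integral_sub (h1.intervalIntegrable _ _)
      ((h2.const_mul _).intervalIntegrable _ _),
    integral_eq_sub_of_hasDerivAt (f := fun θ => arsinh (k * sin θ) ^ 3 / 3 *
      arctan (k * cos θ / √(1 + (k * sin θ) ^ 2))) (fun θ _ => ?_)
      ?_]
  · simp
  · exact (h1.sub (h2.const_mul _)).intervalIntegrable _ _
  · refine ((((((hasDerivAt_sin θ).const_mul k).arsinh).pow 3).div_const 3).mul
      (hasDerivAt_arctan_mul_cos_div_sqrt k θ)).congr_deriv ?_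
    simp only [Pi.pow_apply, smul_eq_mul]
    norm_num
    ring

theorem integral_sq_mul_arctan_sqrt {t k : ℝ} (ht : 0 < t) (hk : 0 ≤ k) :
    ∫ z in (-(2 / t * arsinh k))..(2 / t * arsinh k),
      z ^ 2 * arctan √((1 + k ^ 2) / cosh (t * z / 2) ^ 2 - 1) =
    8 / (3 * t ^ 3) * ∫ θ in (-(π / 2))..(π / 2),
      arsinh (k * sin θ) ^ (2 + 1) / √(1 + (k * sin θ) ^ 2) * (k * sin θ) := by
  have hne : ∀ x : ℝ, √(1 + x ^ 2) ≠ 0 := fun x => (sqrt_pos.2 (by positivity)).ne'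
  have hcosh : ∀ x : ℝ, cosh x ^ 2 ≠ 0 := fun x => by have := cosh_pos x; positivity
  have h := integral_comp_mul_deriv (a := -(π / 2)) (b := π / 2)
    (f := fun θ => 2 / t * arsinh (k * sin θ))
    (f' := fun θ => 2 / t * ((√(1 + (k * sin θ) ^ 2))⁻¹ * (k * cos θ)))
    (g := fun z => z ^ 2 * arctan √((1 + k ^ 2) / cosh (t * z / 2) ^ 2 - 1))
    (fun θ _ => (((hasDerivAt_sin θ).const_mul k).arsinh).const_mul (2 / t))
    (by fun_prop (disch := intros; exact hne _)) (by fun_prop (disch := intros; exact hcosh _))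
  simp only [sin_neg, sin_pi_div_two, mul_neg, mul_one, arsinh_neg] at h
  rw [← h]
  trans ∫ θ in (-(π / 2))..(π / 2), 8 / t ^ 3 * (arsinh (k * sin θ) ^ 2 *
      arctan (k * cos θ / √(1 + (k * sin θ) ^ 2)) * ((√(1 + (k * sin θ) ^ 2))⁻¹ * (k * cos θ)))
  · refine integral_congr fun θ hθ => ?_
    rw [uIcc_of_le (by linarith [pi_pos])] at hθ
    have ha : t * (2 / t * arsinh (k * sin θ)) / 2 = arsinh (k * sin θ) := by field_simp
    simp only [Function.comp_apply]
    rw [ha, sqrt_div_cosh_arsinh_sq_sub_one hk (cos_nonneg_of_mem_Icc hθ)]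
    field_simp
    ring
  · rw [intervalIntegral.integral_const_mul, integral_arsinh_sq_mul_arctan]
    field_simp

theorem tsum_trilogTerm {s : ℝ} (hs : 0 ≤ s) :
    ∑' n, trilogTerm n s = s / 2 * ∑' n : ℕ, exp (-s) ^ (n + 1) / ((n : ℝ) + 1) ^ 2 +
      ∑' n : ℕ, exp (-s) ^ (n + 1) / ((n : ℝ) + 1) ^ 3 := by
  have h0 : ∀ n : ℕ, exp (-s) ^ (n + 1) ≤ 1 := fun n =>
    pow_le_one₀ (exp_pos _).le (exp_le_one_iff.2 (by linarith))
  have h2 : Summable fun n : ℕ => exp (-s) ^ (n + 1) / ((n : ℝ) + 1) ^ 2 :=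
    summable_one_div_add_one_sq.of_nonneg_of_le (fun n => by positivity) fun n => by
      have := h0 n
      gcongr
  have h3 : Summable fun n : ℕ => exp (-s) ^ (n + 1) / ((n : ℝ) + 1) ^ 3 :=
    h2.of_nonneg_of_le (fun n => by positivity) fun n => by
      gcongr
      · simp
      · norm_num
  rw [← tsum_mul_left, ← (h2.mul_left _).tsum_add h3]
  congr 1 with n
  rw [trilogTerm, ← exp_nat_mul]
  push_cast
  rw [mul_neg]
  ring

/-- The second moment of the one-cut density of q-deformed Yang–Mills theory on S²:
with `b = (2/t)·arccosh(e^{t²/(2a)})` (here `arccosh x = log (x + √(x²−1))`) and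
`ρ(z) = (a/(πt))·arctan √(e^{t²/a}/cosh²(tz/2) − 1)`, one has
`∫_{−b}^b z²ρ(z)dz = t²/(3a²) + π²/(3t²) − (4a/t⁴)ζ(3) + (2/t²)Li₂(e^{−t²/a})
  + (4a/t⁴)Li₃(e^{−t²/a})`,
where `ζ(3) = Σ_{n≥1} 1/n³`, `Li₂(x) = Σ_{n≥1} xⁿ/n²`, `Li₃(x) = Σ_{n≥1} xⁿ/n³`. -/
theorem qYM_one_cut_second_moment (t a : ℝ) (ht : 0 < t) (ha : 0 < a) :
    (∫ z in (-((2 / t) * Real.log (Real.exp (t ^ 2 / (2 * a)) +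
        Real.sqrt ((Real.exp (t ^ 2 / (2 * a))) ^ 2 - 1))))..(
      (2 / t) * Real.log (Real.exp (t ^ 2 / (2 * a)) +
        Real.sqrt ((Real.exp (t ^ 2 / (2 * a))) ^ 2 - 1))),
      z ^ 2 * ((a / (Real.pi * t)) *
        Real.arctan (Real.sqrt (Real.exp (t ^ 2 / a) / (Real.cosh (t * z / 2)) ^ 2 - 1))))
    = t ^ 2 / (3 * a ^ 2) + Real.pi ^ 2 / (3 * t ^ 2)
      - (4 * a / t ^ 4) * (∑' n : ℕ, 1 / ((n : ℝ) + 1) ^ 3)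
      + (2 / t ^ 2) * (∑' n : ℕ, (Real.exp (-t ^ 2 / a)) ^ (n + 1) / ((n : ℝ) + 1) ^ 2)
      + (4 * a / t ^ 4) * (∑' n : ℕ, (Real.exp (-t ^ 2 / a)) ^ (n + 1) / ((n : ℝ) + 1) ^ 3) := by
  have hs : 0 ≤ t ^ 2 / a := by positivity
  have he : exp (t ^ 2 / (2 * a)) ^ 2 = exp (t ^ 2 / a) := by
    rw [← exp_nat_mul]
    congr 1
    push_cast
    field_simp
  have hk : 1 + √(exp (t ^ 2 / a) - 1) ^ 2 = exp (t ^ 2 / a) := by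
    rw [sq_sqrt (sub_nonneg.2 (one_le_exp hs))]
    ring
  have hb : log (exp (t ^ 2 / (2 * a)) + √(exp (t ^ 2 / (2 * a)) ^ 2 - 1)) =
      arsinh √(exp (t ^ 2 / a) - 1) := by
    rw [arsinh, hk, ← he, sqrt_sq (exp_pos _).le, add_comm]
  have h := integral_sq_mul_arctan_sqrt ht (sqrt_nonneg (exp (t ^ 2 / a) - 1))
  rw [hk, integral_arsinh_cube_mul_div_sqrt_exp hs, tsum_trilogTerm hs] at h
  rw [hb, neg_div]
  simp_rw [mul_left_comm _ (a / (π * t))]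
  rw [intervalIntegral.integral_const_mul, h]
  field_simp
  ring
end

section
/- For every u ∈ [0, 1), ∫₀^π ( log(1 + u² + 2u·cos θ) )² dθ = 2π · Σ_{m=1}^∞ u^{2m}/m², i.e. the integral equals 2π·Li₂(u²). -/
open MeasureTheory in
/-- Integrating a continuous function against an absolutely convergent cosine series can be done
term by term. -/
theorem hasSum_integral_mul_cos_series {c : ℕ → ℝ} (hc : Summable fun n => |c n|)
    {f g : ℝ → ℝ} (hg : Continuous g)
    (hf : ∀ θ, HasSum (fun n : ℕ => c n * Real.cos (((n : ℝ) + 1) * θ)) (f θ)) (a b : ℝ) :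
    HasSum (fun n : ℕ => c n * ∫ θ in a..b, g θ * Real.cos (((n : ℝ) + 1) * θ))
      (∫ θ in a..b, g θ * f θ) := by
  have key := intervalIntegral.hasSum_integral_of_dominated_convergence (μ := volume)
    (a := a) (b := b) (f := fun θ => g θ * f θ)
    (F := fun (n : ℕ) θ => c n * (g θ * Real.cos (((n : ℝ) + 1) * θ)))
    (fun n θ => |c n| * |g θ|)
    (fun n => (by fun_prop : Continuous _).aestronglyMeasurable)
    (fun n => ae_of_all _ fun θ _ => by
      rw [Real.norm_eq_abs, abs_mul, abs_mul]
      have := Real.abs_cos_le_one (((n : ℝ) + 1) * θ)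
      exact mul_le_mul_of_nonneg_left (mul_le_of_le_one_right (abs_nonneg _) this) (abs_nonneg _))
    (ae_of_all _ fun θ _ => hc.mul_right _)
    (by
      simp only [tsum_mul_right]
      exact (by fun_prop : Continuous fun θ => (∑' n, |c n|) * |g θ|).intervalIntegrable _ _)
    (ae_of_all _ fun θ _ => by
      simpa only [mul_left_comm (g θ)] using (hf θ).mul_left (g θ))
  simpa only [intervalIntegral.integral_const_mul] using key

theorem integral_cos_int_mul_zero_pi {k : ℤ} (hk : k ≠ 0) :
    ∫ θ in (0 : ℝ)..Real.pi, Real.cos ((k : ℝ) * θ) = 0 := by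
  rw [intervalIntegral.integral_comp_mul_left _ (Int.cast_ne_zero.mpr hk)]
  simp [Real.sin_int_mul_pi]

/-- Orthogonality of the cosines of positive frequency on `[0, π]`. -/
theorem integral_cos_mul_cos_zero_pi (m n : ℕ) :
    ∫ θ in (0 : ℝ)..Real.pi, Real.cos (((m : ℝ) + 1) * θ) * Real.cos (((n : ℝ) + 1) * θ)
      = if n = m then Real.pi / 2 else 0 := by
  have h : ∀ θ : ℝ, Real.cos (((m : ℝ) + 1) * θ) * Real.cos (((n : ℝ) + 1) * θ)
      = (Real.cos (((m - n : ℤ) : ℝ) * θ) + Real.cos (((m + n + 2 : ℤ) : ℝ) * θ)) / 2 := by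
    intro θ
    have h1 : ((m - n : ℤ) : ℝ) * θ = ((m : ℝ) + 1) * θ - ((n : ℝ) + 1) * θ := by
      push_cast; ring
    have h2 : ((m + n + 2 : ℤ) : ℝ) * θ = ((m : ℝ) + 1) * θ + ((n : ℝ) + 1) * θ := by
      push_cast; ring
    rw [h1, h2, Real.cos_sub, Real.cos_add]
    ring
  have hi : ∀ k : ℤ, IntervalIntegrable (fun θ : ℝ => Real.cos ((k : ℝ) * θ))
      MeasureTheory.volume 0 Real.pi := fun k =>
    (by fun_prop : Continuous fun θ : ℝ => Real.cos ((k : ℝ) * θ)).intervalIntegrable _ _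
  simp_rw [h]
  rw [intervalIntegral.integral_div, intervalIntegral.integral_add (hi _) (hi _),
    integral_cos_int_mul_zero_pi (k := m + n + 2) (by omega)]
  split_ifs with hmn
  · simp [hmn]
  · rw [integral_cos_int_mul_zero_pi (by omega)]
    simp

theorem one_add_sq_add_two_mul_cos_pos {u : ℝ} (hu : |u| < 1) (θ : ℝ) :
    0 < 1 + u ^ 2 + 2 * u * Real.cos θ := by
  have h1 : |u * Real.cos θ| ≤ |u| := by
    rw [abs_mul]
    exact mul_le_of_le_one_right (abs_nonneg _) (Real.abs_cos_le_one θ)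
  nlinarith [neg_abs_le (u * Real.cos θ), sq_abs u, sq_nonneg (1 - |u|),
    mul_pos (sub_pos.mpr hu) (sub_pos.mpr hu)]

/-- The Fourier series of `log (1 + u² + 2u cos θ)`. -/
theorem hasSum_log_one_add_sq_add_two_mul_cos {u : ℝ} (hu : |u| < 1) (θ : ℝ) :
    HasSum (fun n : ℕ => -2 * (-u) ^ (n + 1) / ((n : ℝ) + 1) * Real.cos (((n : ℝ) + 1) * θ))
      (Real.log (1 + u ^ 2 + 2 * u * Real.cos θ)) := by
  set z : ℂ := ((-u : ℝ) : ℂ) * Complex.exp ((θ : ℂ) * Complex.I) with hz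
  have hz1 : ‖z‖ < 1 := by
    rw [hz, norm_mul, Complex.norm_exp_ofReal_mul_I]
    simpa using hu
  have hs := (hasSum_nat_add_iff' 1).mpr (Complex.hasSum_taylorSeries_neg_log hz1)
  have hre := (Complex.hasSum_re hs).mul_left (-2)
  have hterm : ∀ n : ℕ, -2 * (-u) ^ (n + 1) / ((n : ℝ) + 1) * Real.cos (((n : ℝ) + 1) * θ)
      = -2 * (z ^ (n + 1) / ((n + 1 : ℕ) : ℂ)).re := by
    intro n
    have hp : z ^ (n + 1) / ((n + 1 : ℕ) : ℂ)
        = (((-u) ^ (n + 1) / ((n : ℝ) + 1) : ℝ) : ℂ)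
          * Complex.exp (((((n : ℝ) + 1) * θ : ℝ) : ℂ) * Complex.I) := by
      rw [hz, mul_pow, ← Complex.exp_nat_mul]
      push_cast
      rw [← mul_assoc (_ + 1 : ℂ) (θ : ℂ)]
      ring
    rw [hp, Complex.re_ofReal_mul, Complex.exp_ofReal_mul_I_re]
    ring
  have hval : Real.log (1 + u ^ 2 + 2 * u * Real.cos θ)
      = -2 * (-Complex.log (1 - z) - ∑ i ∈ Finset.range 1, z ^ i / (i : ℂ)).re := by
    have hn : 1 + u ^ 2 + 2 * u * Real.cos θ = ‖1 - z‖ ^ 2 := by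
      rw [Complex.sq_norm, Complex.normSq_apply, hz]
      simp only [Complex.sub_re, Complex.sub_im, Complex.one_re, Complex.one_im,
        Complex.re_ofReal_mul, Complex.im_ofReal_mul, Complex.exp_ofReal_mul_I_re,
        Complex.exp_ofReal_mul_I_im]
      nlinarith [Real.sin_sq_add_cos_sq θ]
    rw [hn, Real.log_pow]
    simp [Complex.log_re]
  simp only [hterm, hval]
  exact hre

/-- For `u ∈ [0,1)`, `∫₀^π (log(1 + u² + 2u cos θ))² dθ = 2π·Li₂(u²)`,
where `Li₂(x) = Σ_{m≥1} x^m/m²`. -/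
theorem integral_sq_log_one_add_cos (u : ℝ) (hu0 : 0 ≤ u) (hu1 : u < 1) :
    (∫ θ in (0 : ℝ)..Real.pi, (Real.log (1 + u ^ 2 + 2 * u * Real.cos θ)) ^ 2)
    = 2 * Real.pi * ∑' m : ℕ, u ^ (2 * (m + 1)) / ((m : ℝ) + 1) ^ 2 := by
  have hu : |u| < 1 := by rwa [abs_of_nonneg hu0]
  have hc : Summable fun n : ℕ => |-2 * (-u) ^ (n + 1) / ((n : ℝ) + 1)| := by
    refine Summable.of_nonneg_of_le (fun n => abs_nonneg _) (fun n => ?_)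
      ((summable_geometric_of_lt_one hu0 hu1).mul_left 2)
    have hn : (1 : ℝ) ≤ (n : ℝ) + 1 := by simp
    rw [abs_div, abs_mul, abs_pow, abs_neg, abs_neg, abs_of_nonneg hu0,
      abs_of_pos (zero_lt_one.trans_le hn), abs_two]
    refine (div_le_self (by positivity) hn).trans ?_
    gcongr 2 * ?_
    exact pow_le_pow_of_le_one hu0 hu1.le n.le_succ
  have hlog := hasSum_log_one_add_sq_add_two_mul_cos hu
  have hcont : Continuous fun θ : ℝ => Real.log (1 + u ^ 2 + 2 * u * Real.cos θ) :=
    Continuous.log (by fun_prop) fun θ => (one_add_sq_add_two_mul_cos_pos hu θ).ne'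
  have hcoeff : ∀ m : ℕ, ∫ θ in (0 : ℝ)..Real.pi,
      Real.log (1 + u ^ 2 + 2 * u * Real.cos θ) * Real.cos (((m : ℝ) + 1) * θ)
        = -2 * (-u) ^ (m + 1) / ((m : ℝ) + 1) * (Real.pi / 2) := by
    intro m
    have h := hasSum_integral_mul_cos_series hc
      (g := fun θ => Real.cos (((m : ℝ) + 1) * θ)) (by fun_prop) hlog 0 Real.pi
    simp_rw [integral_cos_mul_cos_zero_pi] at h
    simp_rw [mul_comm (Real.log _)]
    refine h.unique ?_
    convert hasSum_single m fun n hn => ?_ using 1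
    · simp
    · simp [hn]
  have h := hasSum_integral_mul_cos_series hc hcont hlog 0 Real.pi
  simp_rw [hcoeff, ← sq] at h
  rw [← h.tsum_eq, ← tsum_mul_left]
  congr 1
  funext m
  have hp : u ^ (2 * (m + 1)) = (-u) ^ (m + 1) * (-u) ^ (m + 1) := by
    rw [← mul_pow, neg_mul_neg, pow_mul, sq]
  rw [hp]
  field_simp
end

section
/- For every real q with 0 < q < 1 and every real z, Σ_{n=1}^∞ log( (1 + 2q^{2n}·cos(2z) + q^{4n}) / (1 + q^{2n})² ) = 4 · Σ_{m=1}^∞ ((−1)^m/m) · ( q^{2m}/(1 − q^{2m}) ) · sin²(m z), and both series converge absolutely. -/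
/-- The logarithm of `(1 + 2 x cos 2z + x²) / (1 + x)²` as a power series in `x`. -/
lemma hasSum_log_one_add_cos_div (x z : ℝ) (hx0 : 0 < x) (hx1 : x < 1) :
    HasSum (fun m : ℕ => 4 * ((-1) ^ (m + 1) / ((m : ℝ) + 1) * x ^ (m + 1) *
        Real.sin (((m : ℝ) + 1) * z) ^ 2))
      (Real.log ((1 + 2 * x * Real.cos (2 * z) + x ^ 2) / (1 + x) ^ 2)) := by
  have key : ∀ θ : ℝ, HasSum
      (fun m : ℕ => (-1) ^ (m + 1) / ((m : ℝ) + 1) * x ^ (m + 1) * Real.cos (((m : ℝ) + 1) * θ))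
      (-(Real.log (1 + 2 * x * Real.cos θ + x ^ 2) / 2)) := by
    intro θ
    have hnorm : ‖-((x : ℂ) * Complex.exp (θ * Complex.I))‖ < 1 := by
      rw [norm_neg, norm_mul, Complex.norm_exp_ofReal_mul_I, Complex.norm_real,
        Real.norm_of_nonneg hx0.le, mul_one]
      exact hx1
    have h := Complex.hasSum_re (Complex.hasSum_taylorSeries_neg_log' hnorm)
    convert! h using 1
    · funext m
      have hpow : (-((x : ℂ) * Complex.exp (θ * Complex.I))) ^ (m + 1) / ((m : ℂ) + 1) =
          (((-1) ^ (m + 1) / ((m : ℝ) + 1) * x ^ (m + 1) : ℝ) : ℂ) *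
            Complex.exp (((((m : ℝ) + 1) * θ : ℝ) : ℂ) * Complex.I) := by
        rw [neg_pow, mul_pow, ← Complex.exp_nat_mul]
        push_cast
        ring_nf
      rw [hpow, Complex.re_ofReal_mul, Complex.exp_ofReal_mul_I_re]
    · rw [Complex.neg_re, Complex.log_re, sub_neg_eq_add]
      have hsq : ‖1 + (x : ℂ) * Complex.exp (θ * Complex.I)‖ ^ 2 =
          1 + 2 * x * Real.cos θ + x ^ 2 := by
        rw [← Complex.normSq_eq_norm_sq, Complex.normSq_apply, Complex.add_re, Complex.add_im,
          Complex.re_ofReal_mul, Complex.im_ofReal_mul, Complex.exp_ofReal_mul_I_re,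
          Complex.exp_ofReal_mul_I_im, Complex.one_re, Complex.one_im]
        linear_combination x ^ 2 * Real.sin_sq_add_cos_sq θ
      rw [← hsq, Real.log_pow]
      push_cast
      ring
  have hpos : 0 < 1 + 2 * x * Real.cos (2 * z) + x ^ 2 := by
    nlinarith [Real.neg_one_le_cos (2 * z), mul_pos hx0 (sub_pos.2 hx1), pow_pos (sub_pos.2 hx1) 2]
  convert! ((key 0).sub (key (2 * z))).mul_left 2 using 1
  · funext m
    have hcos : Real.cos (((m : ℝ) + 1) * (2 * z)) =
        1 - 2 * Real.sin (((m : ℝ) + 1) * z) ^ 2 := by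
      rw [show ((m : ℝ) + 1) * (2 * z) = 2 * (((m : ℝ) + 1) * z) by ring, Real.cos_two_mul,
        Real.cos_sq']
      ring
    rw [hcos, mul_zero, Real.cos_zero]
    ring
  · rw [Real.log_div hpos.ne' (by positivity), Real.cos_zero,
      show 1 + 2 * x * 1 + x ^ 2 = (1 + x) ^ 2 by ring]
    ring

lemma summable_lambert_double_series (q z : ℝ) (hq0 : 0 < q) (hq1 : q < 1) :
    Summable (fun p : ℕ × ℕ => 4 * ((-1) ^ (p.2 + 1) / ((p.2 : ℝ) + 1) *
      (q ^ (2 * (p.1 + 1))) ^ (p.2 + 1) * Real.sin (((p.2 : ℝ) + 1) * z) ^ 2)) := by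
  have hgeom := summable_geometric_of_lt_one hq0.le hq1
  have hprod : Summable (fun p : ℕ × ℕ => q ^ p.1 * q ^ p.2) :=
    hgeom.mul_of_nonneg hgeom (fun n => by positivity) (fun n => by positivity)
  refine Summable.of_norm_bounded (hprod.mul_left 4) ?_
  rintro ⟨n, m⟩
  have hcoef : |(-1 : ℝ) ^ (m + 1) / ((m : ℝ) + 1)| ≤ 1 := by
    rw [abs_div, abs_pow, abs_neg, abs_one, one_pow, abs_of_pos (by positivity : (0:ℝ) < m + 1)]
    exact div_le_one_of_le₀ (by linarith [Nat.cast_nonneg (α := ℝ) m]) (by positivity)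
  have hpow : (q ^ (2 * (n + 1))) ^ (m + 1) ≤ q ^ n * q ^ m := by
    rw [← pow_mul, ← pow_add]
    exact pow_le_pow_of_le_one hq0.le hq1.le (by nlinarith)
  have hsin : Real.sin (((m : ℝ) + 1) * z) ^ 2 ≤ 1 := Real.sin_sq_le_one _
  rw [Real.norm_eq_abs, abs_mul, abs_mul, abs_mul, abs_of_nonneg (sq_nonneg (Real.sin _)),
    abs_of_pos (by positivity : 0 < (q ^ (2 * (n + 1))) ^ (m + 1)),
    abs_of_pos (by norm_num : (0 : ℝ) < 4)]
  refine mul_le_mul_of_nonneg_left ?_ (by norm_num)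
  calc _ ≤ 1 * (q ^ n * q ^ m) * 1 := by gcongr
    _ = _ := by ring


/-- For `0 < q < 1` and real `z`, the theta-function identity
`Σ_{n≥1} log((1 + 2q^{2n}cos(2z) + q^{4n})/(1+q^{2n})²)
  = 4 Σ_{m≥1} ((−1)^m/m) (q^{2m}/(1−q^{2m})) sin²(mz)`,
with both series converging absolutely. -/
theorem theta_log_lambert_series (q z : ℝ) (hq0 : 0 < q) (hq1 : q < 1) :
    (Summable fun n : ℕ =>
      |Real.log ((1 + 2 * q ^ (2 * (n + 1)) * Real.cos (2 * z) + q ^ (4 * (n + 1)))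
        / (1 + q ^ (2 * (n + 1))) ^ 2)|) ∧
    (Summable fun m : ℕ =>
      |((-1) ^ (m + 1) / ((m : ℝ) + 1)) * (q ^ (2 * (m + 1)) / (1 - q ^ (2 * (m + 1)))) *
        (Real.sin (((m : ℝ) + 1) * z)) ^ 2|) ∧
    (∑' n : ℕ,
        Real.log ((1 + 2 * q ^ (2 * (n + 1)) * Real.cos (2 * z) + q ^ (4 * (n + 1)))
          / (1 + q ^ (2 * (n + 1))) ^ 2))
      = 4 * ∑' m : ℕ,
          ((-1) ^ (m + 1) / ((m : ℝ) + 1)) * (q ^ (2 * (m + 1)) / (1 - q ^ (2 * (m + 1)))) *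
            (Real.sin (((m : ℝ) + 1) * z)) ^ 2 := by
  have hrow : ∀ n : ℕ, HasSum (fun m : ℕ => 4 * ((-1) ^ (m + 1) / ((m : ℝ) + 1) *
      (q ^ (2 * (n + 1))) ^ (m + 1) * Real.sin (((m : ℝ) + 1) * z) ^ 2))
      (Real.log ((1 + 2 * q ^ (2 * (n + 1)) * Real.cos (2 * z) + q ^ (4 * (n + 1)))
        / (1 + q ^ (2 * (n + 1))) ^ 2)) := by
    intro n
    have h := hasSum_log_one_add_cos_div (q ^ (2 * (n + 1))) z (by positivity)
      (pow_lt_one₀ hq0.le hq1 (by omega))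
    rwa [← pow_mul q (2 * (n + 1)) 2, show 2 * (n + 1) * 2 = 4 * (n + 1) by ring] at h
  have hcol : ∀ m : ℕ, HasSum (fun n : ℕ => 4 * ((-1) ^ (m + 1) / ((m : ℝ) + 1) *
      (q ^ (2 * (n + 1))) ^ (m + 1) * Real.sin (((m : ℝ) + 1) * z) ^ 2))
      (4 * (((-1) ^ (m + 1) / ((m : ℝ) + 1)) * (q ^ (2 * (m + 1)) / (1 - q ^ (2 * (m + 1)))) *
        Real.sin (((m : ℝ) + 1) * z) ^ 2)) := by
    intro m
    have h := (hasSum_geometric_of_lt_one (r := q ^ (2 * (m + 1))) (by positivity)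
      (pow_lt_one₀ hq0.le hq1 (by omega))).mul_left (q ^ (2 * (m + 1)))
    have hgeom : HasSum (fun n : ℕ => (q ^ (2 * (n + 1))) ^ (m + 1))
        (q ^ (2 * (m + 1)) / (1 - q ^ (2 * (m + 1)))) := by
      rw [div_eq_mul_inv]
      convert! h using 2 with n
      rw [← pow_succ', ← pow_mul, ← pow_mul]
      congr 1
      ring
    exact ((hgeom.mul_left _).mul_right _).mul_left 4
  have hsum := (summable_lambert_double_series q z hq0 hq1).hasSum
  have hlog := hsum.prod_fiberwise hrow
  have hlambert := ((Equiv.prodComm ℕ ℕ).hasSum_iff.2 hsum).prod_fiberwise hcol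
  refine ⟨hlog.summable.abs, ?_, ?_⟩
  · exact ((summable_mul_left_iff (by norm_num : (4 : ℝ) ≠ 0)).1 hlambert.summable).abs
  · rw [← tsum_mul_left, hlog.tsum_eq, hlambert.tsum_eq]
end

section
/- Let A > 0 and let δ, α, β, γ be real numbers with 0 < δ < α < β < γ, α·β = A and δ·γ = A. Then ∫_α^β w / √( (w−δ)(w−α)(β−w)(γ−w) ) dw = A · ∫_α^β 1 / ( w·√( (w−δ)(w−α)(β−w)(γ−w) ) ) dw, both (convergent improper) integrals being finite. -/
open MeasureTheory

open Set intervalIntegral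

/-- A continuous function divided by the square root of a quartic vanishing simply at the endpoints
is integrable. -/
theorem intervalIntegrable_div_sqrt_quartic {δ α β γ : ℝ} (hδα : δ < α) (hαβ : α < β)
    (hβγ : β < γ) {g : ℝ → ℝ} (hg : ContinuousOn g (Icc α β)) :
    IntervalIntegrable (fun w => g w / √((w - δ) * (w - α) * (β - w) * (γ - w))) volume α β := by
  have hF : IntervalIntegrable (fun w => 1 / (2 * √(w - α)) + 1 / (2 * √(β - w))) volume α β := by
    rw [intervalIntegrable_iff_integrableOn_Ioc_of_le hαβ.le]
    refine integrableOn_deriv_of_nonneg (g := fun w => √(w - α) - √(β - w)) (by fun_prop)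
      (fun w hw => ?_) (fun w _ => by positivity)
    have h₁ := ((hasDerivAt_id w).sub_const α).sqrt (sub_pos.2 hw.1).ne'
    have h₂ := ((hasDerivAt_id w).const_sub β).sqrt (sub_pos.2 hw.2).ne'
    refine (h₁.sub h₂).congr_deriv ?_
    simp only [id_eq]
    ring
  have hG : ContinuousOn
      (fun w => 2 * g w / (√(w - δ) * √(γ - w) * (√(w - α) + √(β - w)))) (uIcc α β) := by
    rw [uIcc_of_le hαβ.le]
    refine (continuousOn_const.mul hg).div (by fun_prop) (fun w hw => ?_)
    have h₁ : 0 < √(w - δ) := Real.sqrt_pos.2 (by linarith [hw.1])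
    have h₂ : 0 < √(γ - w) := Real.sqrt_pos.2 (by linarith [hw.2])
    have h₃ : 0 < √(w - α) + √(β - w) := by
      rcases hw.1.eq_or_lt with rfl | h
      · exact add_pos_of_nonneg_of_pos (Real.sqrt_nonneg _) (Real.sqrt_pos.2 (sub_pos.2 hαβ))
      · exact add_pos_of_pos_of_nonneg (Real.sqrt_pos.2 (sub_pos.2 h)) (Real.sqrt_nonneg _)
    positivity
  have hFG := hF.mul_continuousOn hG
  rw [intervalIntegrable_iff_integrableOn_Ioo_of_le hαβ.le] at hFG ⊢
  refine hFG.congr_fun (fun w hw => ?_) measurableSet_Ioo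
  obtain ⟨hw₁, hw₂⟩ := hw
  have hδw : 0 < w - δ := by linarith
  have hαw : 0 < w - α := by linarith
  have hwβ : 0 < β - w := by linarith
  have hwγ : 0 < γ - w := by linarith
  have h₁ := Real.sqrt_pos.2 hδw
  have h₂ := Real.sqrt_pos.2 hαw
  have h₃ := Real.sqrt_pos.2 hwβ
  have h₄ := Real.sqrt_pos.2 hwγ
  simp only
  rw [Real.sqrt_mul (by positivity), Real.sqrt_mul (by positivity), Real.sqrt_mul hδw.le]
  field_simp
  ring

/-- The inversion `w ↦ A / w` with `A = α * β` maps `(α, β)` onto itself. -/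
theorem image_const_div_Ioo {A α β : ℝ} (hα : 0 < α) (hβ : 0 < β) (hab : α * β = A) :
    (fun w => A / w) '' Ioo α β = Ioo α β := by
  subst hab
  have hmaps : ∀ w ∈ Ioo α β, α * β / w ∈ Ioo α β := fun w hw => by
    have hw₀ : 0 < w := hα.trans hw.1
    constructor
    · rw [lt_div_iff₀ hw₀]
      exact mul_lt_mul_of_pos_left hw.2 hα
    · rw [div_lt_iff₀ hw₀, mul_comm]
      exact mul_lt_mul_of_pos_left hw.1 hβ
  refine Subset.antisymm (image_subset_iff.2 hmaps) fun w hw => ⟨α * β / w, hmaps w hw, ?_⟩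
  have hw₀ : 0 < w := hα.trans hw.1
  simp only
  field_simp

/-- The quartic is self-reciprocal under the inversion `w ↦ A / w`. -/
theorem sqrt_quartic_const_div {A δ α β γ w : ℝ} (hA : 0 < A) (hw : w ≠ 0)
    (hab : α * β = A) (hdg : δ * γ = A) :
    √((A / w - δ) * (A / w - α) * (β - A / w) * (γ - A / w)) =
      A / w ^ 2 * √((w - δ) * (w - α) * (β - w) * (γ - w)) := by
  have h : (A / w - δ) * (A / w - α) * (β - A / w) * (γ - A / w) =
      (A / w ^ 2) ^ 2 * ((w - δ) * (w - α) * (β - w) * (γ - w)) := by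
    have h₁ : (A / w - δ) * (γ - A / w) = A / w ^ 2 * ((w - δ) * (γ - w)) := by
      rw [← hdg]; field_simp
    have h₂ : (A / w - α) * (β - A / w) = A / w ^ 2 * ((w - α) * (β - w)) := by
      rw [← hab]; field_simp
    linear_combination (A / w - α) * (β - A / w) * h₁ + A / w ^ 2 * ((w - δ) * (γ - w)) * h₂
  rw [h, Real.sqrt_mul (sq_nonneg _), Real.sqrt_sq (by positivity)]

/-- With `0 < δ < α < β < γ`, `αβ = A` and `δγ = A`, the inversion `w ↦ A/w` identity
for the fluctuation moments of the two-cut solution: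
`∫_α^β w/√((w−δ)(w−α)(β−w)(γ−w)) dw = A·∫_α^β dw/(w√((w−δ)(w−α)(β−w)(γ−w)))`,
both (convergent improper) integrals being finite. -/
theorem two_cut_moment_inversion (A δ α β γ : ℝ) (hA : 0 < A)
    (hδ : 0 < δ) (hδα : δ < α) (hαβ : α < β) (hβγ : β < γ)
    (hab : α * β = A) (hdg : δ * γ = A) :
    IntervalIntegrable
        (fun w => w / Real.sqrt ((w - δ) * (w - α) * (β - w) * (γ - w))) volume α β ∧
    IntervalIntegrable
        (fun w => 1 / (w * Real.sqrt ((w - δ) * (w - α) * (β - w) * (γ - w)))) volume α β ∧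
    (∫ w in α..β, w / Real.sqrt ((w - δ) * (w - α) * (β - w) * (γ - w)))
      = A * ∫ w in α..β, 1 / (w * Real.sqrt ((w - δ) * (w - α) * (β - w) * (γ - w))) := by
  have hα : 0 < α := hδ.trans hδα
  have hβ : 0 < β := hα.trans hαβ
  refine ⟨intervalIntegrable_div_sqrt_quartic hδα hαβ hβγ continuousOn_id, ?_, ?_⟩
  · simp_rw [← div_div]
    exact intervalIntegrable_div_sqrt_quartic hδα hαβ hβγ
      (continuousOn_const.div continuousOn_id fun w hw => (hα.trans_le hw.1).ne')
  · rw [integral_of_le hαβ.le, integral_of_le hαβ.le, integral_Ioc_eq_integral_Ioo,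
      integral_Ioc_eq_integral_Ioo, ← MeasureTheory.integral_const_mul]
    have hderiv : ∀ w ∈ Ioo α β,
        HasDerivWithinAt (fun w => A / w) (-A / w ^ 2) (Ioo α β) w := fun w hw => by
      have h := ((hasDerivAt_inv (hα.trans hw.1).ne').const_mul A).hasDerivWithinAt (s := Ioo α β)
      refine h.congr_deriv ?_
      ring
    have hinj : InjOn (fun w => A / w) (Ioo α β) := fun x _ y _ hxy => by
      simpa [div_eq_mul_inv, hA.ne'] using hxy
    have hcv := integral_image_eq_integral_abs_deriv_smul measurableSet_Ioo hderiv hinj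
      fun w => w / √((w - δ) * (w - α) * (β - w) * (γ - w))
    rw [image_const_div_Ioo hα hβ hab] at hcv
    rw [hcv]
    refine setIntegral_congr_fun measurableSet_Ioo fun w hw => ?_
    have hw₀ : 0 < w := hα.trans hw.1
    have hP : 0 < √((w - δ) * (w - α) * (β - w) * (γ - w)) := by
      obtain ⟨hw₁, hw₂⟩ := hw
      have h₁ : 0 < w - δ := by linarith
      have h₂ : 0 < w - α := by linarith
      have h₃ : 0 < β - w := by linarith
      have h₄ : 0 < γ - w := by linarith
      positivity
    simp only [smul_eq_mul]
    rw [sqrt_quartic_const_div hA hw₀.ne' hab hdg, neg_div, abs_neg, abs_of_pos (by positivity)]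
    field_simp
end
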